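/- arXiv:2107.01234 — 2 statements merged into one kernel-verified Lean document; each statement's English description precedes it below -/
import Mathlib

section
/- For every integer N ≥ 3, the number of tuples (a_1, …, a_N) of positive integers satisfying M(a_1)·M(a_2)···M(a_N) = −Id and a_1 + ⋯ + a_N = 3N − 6 equals the Catalan number C_{N−2} = (1/(N−1))·C(2(N−2), N−2). -/
/-- The matrix `M(a)` with first row `(a, -1)` and second row `(1, 0)`. -/
def M (a : ℤ) : Matrix (Fin 2) (Fin 2) ℤ := !![a, -1; 1, 0]

/-- The number of triangles at the left end of the root edge, in the triangulation of a polygon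
encoded by a binary tree. -/
def leftCount : BinaryTree Unit → ℤ
  | .nil => 0
  | .node _ l _ => leftCount l + 1

/-- The number of triangles at the right end of the root edge, in the triangulation of a polygon
encoded by a binary tree. -/
def rightCount : BinaryTree Unit → ℤ
  | .nil => 0
  | .node _ _ r => rightCount r + 1

/-- The numbers of triangles at the vertices off the root edge, in the triangulation of a polygon
encoded by a binary tree. -/
def innerCounts : BinaryTree Unit → List ℤ
  | .nil => []
  | .node _ l r => innerCounts l ++ (rightCount l + leftCount r + 1) :: innerCounts r

/-- The quiddity of the triangulation encoded by a binary tree. -/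
def quiddity (t : BinaryTree Unit) : List ℤ :=
  leftCount t :: (innerCounts t ++ [rightCount t])

/-- The product `M(a₁) ⋯ M(aₙ)` along a list. -/
def prodM (l : List ℤ) : Matrix (Fin 2) (Fin 2) ℤ := (l.map M).prod

@[simp] theorem prodM_nil : prodM [] = 1 := rfl

@[simp] theorem prodM_cons (a : ℤ) (l : List ℤ) : prodM (a :: l) = M a * prodM l := by
  simp [prodM]

@[simp] theorem prodM_append (l l' : List ℤ) : prodM (l ++ l') = prodM l * prodM l' := by
  simp [prodM]

theorem M_mul_apply_zero_zero (a : ℤ) (X : Matrix (Fin 2) (Fin 2) ℤ) :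
    (M a * X) 0 0 = a * X 0 0 - X 1 0 := by
  simp [M, Matrix.mul_apply, Fin.sum_univ_two]; ring

theorem M_mul_apply_one_zero (a : ℤ) (X : Matrix (Fin 2) (Fin 2) ℤ) :
    (M a * X) 1 0 = X 0 0 := by
  simp [M, Matrix.mul_apply, Fin.sum_univ_two]

theorem M_ear (a b : ℤ) : M a * M 1 * M b = M (a - 1) * M (b - 1) := by
  ext i j; fin_cases i <;> fin_cases j <;> simp [M] <;> ring

theorem M_mul_M_zero_mul_M (a b : ℤ) : M a * M 0 * M b = -M (a + b) := by
  ext i j; fin_cases i <;> fin_cases j <;> simp [M, add_comm]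

/-! ### Quiddities of trees -/

theorem prodM_innerCounts (t : BinaryTree Unit) :
    prodM (innerCounts t) =
      !![1, -rightCount t; leftCount t, 1 - leftCount t * rightCount t] := by
  induction t with
  | nil => ext i j; fin_cases i <;> fin_cases j <;> simp [innerCounts, leftCount, rightCount]
  | node _ l r hl hr =>
    simp only [innerCounts, prodM_append, prodM_cons, hl, hr, leftCount, rightCount, M]
    ext i j; fin_cases i <;> fin_cases j <;> simp <;> ring

theorem prodM_quiddity (t : BinaryTree Unit) : prodM (quiddity t) = -1 := by
  simp only [quiddity, prodM_cons, prodM_append, prodM_nil, prodM_innerCounts, M]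
  ext i j; fin_cases i <;> fin_cases j <;> simp

theorem length_innerCounts (t : BinaryTree Unit) : (innerCounts t).length = t.numNodes := by
  induction t with
  | nil => rfl
  | node _ l r hl hr => simp [innerCounts, BinaryTree.numNodes, hl, hr]; omega

theorem length_quiddity (t : BinaryTree Unit) : (quiddity t).length = t.numNodes + 2 := by
  simp [quiddity, length_innerCounts]

theorem sum_quiddity (t : BinaryTree Unit) : (quiddity t).sum = 3 * t.numNodes := by
  induction t with
  | nil => rfl
  | node _ l r hl hr =>
    simp only [quiddity, innerCounts, leftCount, rightCount, BinaryTree.numNodes, List.sum_cons,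
      List.sum_append, List.sum_nil] at *
    push_cast
    linarith

theorem leftCount_nonneg (t : BinaryTree Unit) : 0 ≤ leftCount t := by
  induction t with
  | nil => rfl
  | node _ l r hl hr => simp only [leftCount]; omega

theorem rightCount_nonneg (t : BinaryTree Unit) : 0 ≤ rightCount t := by
  induction t with
  | nil => rfl
  | node _ l r hl hr => simp only [rightCount]; omega

theorem innerCounts_pos (t : BinaryTree Unit) : ∀ a ∈ innerCounts t, 0 < a := by
  induction t with
  | nil => simp [innerCounts]
  | node _ l r hl hr =>
    intro a ha
    have := rightCount_nonneg l
    have := leftCount_nonneg r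
    simp only [innerCounts, List.mem_append, List.mem_cons] at ha
    rcases ha with h | rfl | h
    · exact hl a h
    · omega
    · exact hr a h

theorem quiddity_pos {t : BinaryTree Unit} (ht : t ≠ .nil) : ∀ a ∈ quiddity t, 0 < a := by
  intro a ha
  simp only [quiddity, List.mem_cons, List.mem_append, List.not_mem_nil, or_false] at ha
  rcases ha with rfl | h | rfl
  · cases t with
    | nil => exact absurd rfl ht
    | node _ l r => have := leftCount_nonneg l; simp only [leftCount]; omega
  · exact innerCounts_pos t a h
  · cases t with
    | nil => exact absurd rfl ht
    | node _ l r => have := rightCount_nonneg r; simp only [rightCount]; omega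

/-- Positivity of the entries of the frieze of a triangulation. -/
theorem prodM_prefix_pos (t : BinaryTree Unit) {u v : List ℤ} (h : u ++ v = innerCounts t) :
    0 < prodM u 0 0 ∧ (v ≠ [] → 0 < leftCount t * prodM u 0 0 - prodM u 1 0) := by
  induction t generalizing u v with
  | nil =>
    simp only [innerCounts, List.append_eq_nil_iff] at h
    simp [h.1, h.2]
  | node _ l r hl hr =>
    have hP := prodM_innerCounts l
    have hl0 : leftCount l * prodM (innerCounts l) 0 0 - prodM (innerCounts l) 1 0 = 0 := by
      simp [hP]
    simp only [innerCounts, leftCount] at h ⊢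
    have left : ∀ z, u ++ z = innerCounts l →
        0 < prodM u 0 0 ∧ 0 < (leftCount l + 1) * prodM u 0 0 - prodM u 1 0 := by
      intro z hz
      obtain ⟨h1, h2⟩ := hl hz
      refine ⟨h1, ?_⟩
      rcases eq_or_ne z [] with rfl | hz0
      · rw [List.append_nil] at hz
        rw [← hz] at hl0
        linarith
      · linarith [h2 hz0]
    rcases List.append_eq_append_iff.1 h with ⟨z, hz, -⟩ | ⟨z, hz, hz'⟩
    · exact ⟨(left z hz.symm).1, fun _ => (left z hz.symm).2⟩
    · rcases z with _ | ⟨s, z⟩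
      · have := left [] (by simp [hz])
        exact ⟨this.1, fun _ => this.2⟩
      · simp only [List.cons_append, List.cons.injEq] at hz'
        obtain ⟨rfl, hz'⟩ := hz'
        obtain ⟨h1, h2⟩ := hr hz'.symm
        have hr0 : leftCount r * prodM (innerCounts r) 0 0 - prodM (innerCounts r) 1 0 = 0 := by
          simp [prodM_innerCounts r]
        have e0 : prodM u 0 0 = (leftCount r + 1) * prodM z 0 0 - prodM z 1 0 := by
          rw [hz, prodM_append, hP, Matrix.mul_apply, Fin.sum_univ_two, prodM_cons,
            M_mul_apply_zero_zero, M_mul_apply_one_zero]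
          simp; ring
        have e1 : prodM u 1 0 = (leftCount l * (leftCount r + 1) + 1) * prodM z 0 0
            - leftCount l * prodM z 1 0 := by
          rw [hz, prodM_append, hP, Matrix.mul_apply, Fin.sum_univ_two, prodM_cons,
            M_mul_apply_zero_zero, M_mul_apply_one_zero]
          simp; ring
        rw [e0, e1]
        constructor
        · rcases eq_or_ne v [] with rfl | hv
          · rw [List.append_nil] at hz'
            rw [hz'] at hr0
            linarith
          · linarith [h2 hv]
        · intro hv
          linarith [h2 hv]

theorem innerCounts_injective : Function.Injective innerCounts := by
  have not_prefix : ∀ {l l' : BinaryTree Unit} {z : List ℤ}, leftCount l = leftCount l' →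
      innerCounts l' = innerCounts l ++ z → z = [] := by
    intro l l' z hx h
    by_contra hz
    have := (prodM_prefix_pos l' h.symm).2 hz
    simp [prodM_innerCounts, hx] at this
  have left_eq : ∀ {t t' : BinaryTree Unit}, innerCounts t = innerCounts t' →
      leftCount t = leftCount t' ∧ rightCount t = rightCount t' := by
    intro t t' h
    have h' := congrArg prodM h
    rw [prodM_innerCounts, prodM_innerCounts] at h'
    have h10 := congrFun (congrFun h' 1) 0
    have h01 := congrFun (congrFun h' 0) 1
    simp at h10 h01
    exact ⟨h10, h01⟩
  intro t
  induction t with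
  | nil => intro t' h; cases t' <;> simp_all [innerCounts]
  | node _ l r hl hr =>
    intro t' h
    cases t' with
    | nil => simp [innerCounts] at h
    | node _ l' r' =>
      have hx := (left_eq h).1
      simp only [leftCount, add_left_inj] at hx
      simp only [innerCounts] at h
      have hll : innerCounts l = innerCounts l' := by
        rcases List.append_eq_append_iff.1 h with ⟨z, hz, -⟩ | ⟨z, hz, -⟩
        · have := not_prefix hx hz
          simpa [this] using hz.symm
        · have := not_prefix hx.symm hz
          simpa [this] using hz
      rw [hll, List.append_cancel_left_eq, List.cons.injEq] at h
      rw [hl hll, hr h.2]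

theorem quiddity_injective : Function.Injective quiddity := by
  intro t t' h
  simp only [quiddity, List.cons.injEq] at h
  exact innerCounts_injective (List.append_inj_left' h.2 rfl)

/-- Gluing a triangle on an edge of a triangulated polygon other than the root edge. The shifts
`α` and `β` of the counts at the ends of the root edge make the induction go through. -/
theorem exists_glue_triangle (t : BinaryTree Unit) (α β : ℤ) {u w : List ℤ} {c d : ℤ}
    (h : (leftCount t + α) :: (innerCounts t ++ [rightCount t + β]) = u ++ c :: d :: w) :
    ∃ t' : BinaryTree Unit, (leftCount t' + α) :: (innerCounts t' ++ [rightCount t' + β]) =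
      u ++ (c + 1) :: 1 :: (d + 1) :: w := by
  induction t generalizing α β u w c d with
  | nil =>
    refine ⟨.node () .nil .nil, ?_⟩
    rcases u with _ | ⟨e, _ | ⟨e', u⟩⟩ <;> simp [leftCount, rightCount, innerCounts] at h ⊢
    obtain ⟨rfl, rfl, rfl⟩ := h
    simp [add_comm]
  | node _ l r hl hr =>
    have right : ∀ z : List ℤ, u = (leftCount l + 1 + α) :: innerCounts l ++ z →
        (rightCount l + leftCount r + 1) :: (innerCounts r ++ [rightCount r + 1 + β]) =
          z ++ c :: d :: w →
        ∃ t' : BinaryTree Unit, (leftCount t' + α) :: (innerCounts t' ++ [rightCount t' + β]) =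
          u ++ (c + 1) :: 1 :: (d + 1) :: w := by
      intro z hu hz
      obtain ⟨r', hr'⟩ := hr (rightCount l + 1) (1 + β) (u := z) (w := w) (c := c) (d := d)
        (by rw [← hz]; simp [add_comm, add_left_comm, add_assoc])
      refine ⟨.node () l r', ?_⟩
      simp only [leftCount, innerCounts, rightCount, hu, List.append_assoc, ← hr']
      simp [add_comm, add_left_comm, add_assoc]
    have left : ∀ z z' : List ℤ, (leftCount l + 1 + α) :: innerCounts l = u ++ c :: z →
        z ++ [rightCount l + leftCount r + 1] = d :: z' →
        w = z' ++ (innerCounts r ++ [rightCount r + 1 + β]) →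
        ∃ t' : BinaryTree Unit, (leftCount t' + α) :: (innerCounts t' ++ [rightCount t' + β]) =
          u ++ (c + 1) :: 1 :: (d + 1) :: w := by
      intro z z' hz hd hw
      obtain ⟨l', hl'⟩ := hl (1 + α) (leftCount r + 1) (u := u) (w := z') (c := c) (d := d) (by
        rw [← hd, ← List.cons_append, ← add_assoc, hz, ← add_assoc]; simp)
      refine ⟨.node () l' r, ?_⟩
      have := congrArg (· ++ (innerCounts r ++ [rightCount r + 1 + β])) hl'
      simp only [leftCount, innerCounts, rightCount, hw]
      simpa [add_assoc] using this
    simp only [leftCount, innerCounts, rightCount, List.append_assoc, List.cons_append] at h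
    rw [← List.cons_append] at h
    rcases List.append_eq_append_iff.1 h with ⟨z, hz, hz'⟩ | ⟨z, hz, hz'⟩
    · exact right z hz hz'
    · rcases z with _ | ⟨e, z⟩
      · exact right [] (by simpa using hz.symm) (by simpa using hz'.symm)
      · simp only [List.cons_append, List.cons.injEq] at hz'
        obtain ⟨rfl, hz'⟩ := hz'
        rcases z with _ | ⟨e', z⟩
        · simp only [List.nil_append, List.cons.injEq] at hz'
          exact left [] [] hz (by simp [hz'.1]) (by simp [hz'.2])
        · simp only [List.cons_append, List.cons.injEq] at hz'
          exact left (e' :: z) (z ++ [rightCount l + leftCount r + 1]) hz (by simp [hz'.1])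
            (by simp [hz'.2])

theorem exists_quiddity_eq_glue {t : BinaryTree Unit} {u w : List ℤ} {c d : ℤ}
    (h : quiddity t = u ++ c :: d :: w) :
    ∃ t' : BinaryTree Unit, quiddity t' = u ++ (c + 1) :: 1 :: (d + 1) :: w := by
  simpa [quiddity] using exists_glue_triangle t 0 0 (by simpa [quiddity] using h)

/-! ### Solutions of the Conway–Coxeter equation -/

theorem eq_one_or_neg_one_mul_comm {A B : Matrix (Fin 2) (Fin 2) ℤ}
    (h : A * B = 1 ∨ A * B = -1) : B * A = 1 ∨ B * A = -1 := by
  rcases h with h | h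
  · exact .inl (mul_eq_one_comm.1 h)
  · right
    have h1 : -A * B = 1 := by rw [neg_mul, h, neg_neg]
    have h2 := mul_eq_one_comm.1 h1
    rw [mul_neg] at h2
    rw [← h2, neg_neg]

theorem prodM_growth {l : List ℤ} (h : ∀ a ∈ l, 2 ≤ a) :
    0 ≤ prodM l 1 0 ∧ prodM l 1 0 < prodM l 0 0 := by
  induction l with
  | nil => simp
  | cons a l ih =>
    obtain ⟨h1, h2⟩ := ih fun b hb => h b (List.mem_cons_of_mem _ hb)
    have ha := h a List.mem_cons_self
    rw [prodM_cons, M_mul_apply_zero_zero, M_mul_apply_one_zero]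
    constructor
    · linarith
    · nlinarith

/-- A positive solution has an entry `1` away from its ends. -/
theorem exists_inner_one {a b : ℤ} {l : List ℤ} (ha : 0 < a) (hl : ∀ x ∈ l, 0 < x)
    (h : prodM (a :: (l ++ [b])) = 1 ∨ prodM (a :: (l ++ [b])) = -1) : 1 ∈ l := by
  by_contra h1
  obtain ⟨g0, g1⟩ := prodM_growth (l := l) fun x hx => by
    have := hl x hx
    have : x ≠ 1 := fun hx1 => h1 (hx1 ▸ hx)
    omega
  have hP : prodM (a :: (l ++ [b])) 1 1 = -prodM l 0 0 ∧
      prodM (a :: (l ++ [b])) 0 1 = -(a * prodM l 0 0 - prodM l 1 0) := by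
    simp [M, Matrix.mul_apply, Fin.sum_univ_two]; ring
  have h01 : a * prodM l 0 0 - prodM l 1 0 = 0 := by
    have := hP.2
    rcases h with h | h <;> rw [h] at this <;> simp at this <;> linarith
  nlinarith

theorem M_ne_one_and_ne_neg_one (a : ℤ) : ¬(M a = 1 ∨ M a = -1) := by
  rintro (h | h) <;> simpa [M] using congrFun (congrFun h 1) 0

/-- The Conway–Coxeter theorem: a nonnegative solution of length `N` has sum at most `3N - 6`,
with equality only for quiddities of triangulations. -/
theorem conway_coxeter (l : List ℤ) (hl : l ≠ []) (hpos : ∀ a ∈ l, 0 ≤ a)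
    (h : prodM l = 1 ∨ prodM l = -1) :
    l.sum ≤ 3 * l.length - 6 ∧ (l.sum = 3 * l.length - 6 → ∃ t, quiddity t = l) := by
  induction hn : l.length using Nat.strong_induction_on generalizing l with
  | _ n ih =>
  subst hn
  by_cases h0 : 0 ∈ l
  · obtain ⟨u, v, rfl⟩ := List.append_of_mem h0
    have hk : prodM (0 :: (v ++ u)) = 1 ∨ prodM (0 :: (v ++ u)) = -1 := by
      rw [prodM_append] at h
      simpa [mul_assoc] using eq_one_or_neg_one_mul_comm h
    have hlen : (u ++ 0 :: v).length = (v ++ u).length + 1 := by simp; omega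
    have hsum : (u ++ 0 :: v).sum = (v ++ u).sum := by simp [add_comm]
    have hmem : ∀ a ∈ v ++ u, 0 ≤ a := fun a ha => hpos a (by
      simp only [List.mem_append, List.mem_cons] at ha ⊢; tauto)
    rcases hk0 : v ++ u with _ | ⟨b, k⟩
    · simp only [hk0, prodM_cons, prodM_nil, mul_one] at hk
      exact absurd hk (M_ne_one_and_ne_neg_one 0)
    rcases List.eq_nil_or_concat k with rfl | ⟨w, d, rfl⟩
    · have hb : b = 0 := by
        rw [hk0] at hk
        rcases hk with h | h <;> simpa [M] using congrFun (congrFun h 1) 0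
      subst hb
      refine ⟨by simp [hlen, hsum, hk0], fun _ => ⟨.nil, ?_⟩⟩
      rcases List.append_eq_singleton_iff.1 hk0 with ⟨rfl, rfl⟩ | ⟨rfl, rfl⟩ <;>
        simp [quiddity, leftCount, rightCount, innerCounts]
    · rw [List.concat_eq_append] at hk0
      have hw : prodM ((d + b) :: w) = 1 ∨ prodM ((d + b) :: w) = -1 := by
        rw [hk0] at hk
        have h1 : (M 0 * M b * prodM w) * M d = 1 ∨ (M 0 * M b * prodM w) * M d = -1 := by
          simpa [mul_assoc] using hk
        have h2 := eq_one_or_neg_one_mul_comm h1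
        rw [← mul_assoc, ← mul_assoc, M_mul_M_zero_mul_M, neg_mul] at h2
        rw [prodM_cons]
        rcases h2 with h2 | h2
        · exact .inr (neg_eq_iff_eq_neg.1 h2)
        · exact .inl (neg_injective h2)
      rw [hk0] at hlen hsum hmem
      simp only [List.length_cons, List.length_append, List.length_nil, List.sum_cons,
        List.sum_append, List.sum_nil, List.mem_cons, List.mem_append] at hlen hsum hmem
      have hb := hmem b (by simp)
      have hd := hmem d (by simp)
      have key := (ih ((d + b) :: w).length (by simp only [List.length_append, List.length_cons]; omega) ((d + b) :: w) (by simp)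
        (by
          intro a ha
          rcases List.mem_cons.1 ha with rfl | ha
          · omega
          · exact hmem a (by simp [ha])) hw rfl).1
      simp only [List.length_cons, List.sum_cons] at key
      have : (u ++ 0 :: v).sum < 3 * (u ++ 0 :: v).length - 6 := by
        simp only [List.length_append, List.length_cons, List.sum_append, List.sum_cons]
        rw [hlen, hsum]; push_cast at key ⊢; linarith
      exact ⟨this.le, fun h => absurd h this.ne⟩
  · have hpos' : ∀ a ∈ l, 0 < a := fun a ha =>
      lt_of_le_of_ne (hpos a ha) fun h => h0 (h ▸ ha)
    rcases l with _ | ⟨a, l⟩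
    · exact absurd rfl hl
    rcases List.eq_nil_or_concat l with rfl | ⟨k, b, rfl⟩
    · simp only [prodM_cons, prodM_nil, mul_one] at h
      exact absurd h (M_ne_one_and_ne_neg_one a)
    rw [List.concat_eq_append] at *
    obtain ⟨p, q, rfl⟩ := List.append_of_mem
      (exists_inner_one (hpos' a (by simp)) (fun x hx => hpos' x (by simp [hx])) h)
    obtain ⟨u, c, hu⟩ : ∃ u c, a :: p = u ++ [c] := by
      rcases List.eq_nil_or_concat (a :: p) with h | ⟨u, c, h⟩
      · simp at h
      · exact ⟨u, c, by simpa using h⟩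
    obtain ⟨d, w, hw⟩ : ∃ d w, q ++ [b] = d :: w := by
      rcases q with _ | ⟨d, w⟩
      · exact ⟨b, [], rfl⟩
      · exact ⟨d, w ++ [b], rfl⟩
    have hL : a :: (p ++ 1 :: q ++ [b]) = u ++ c :: 1 :: d :: w := by
      rw [List.append_assoc, List.cons_append, hw, ← List.cons_append, hu]; simp
    rw [hL] at hpos h ih hpos' ⊢
    have hc := hpos' c (by simp)
    have hd := hpos' d (by simp)
    have hred : prodM (u ++ (c - 1) :: (d - 1) :: w) = prodM (u ++ c :: 1 :: d :: w) := by
      simp only [prodM_append, prodM_cons]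
      rw [← mul_assoc (M (c - 1)), ← M_ear]
      simp only [mul_assoc]
    obtain ⟨h1, h2⟩ := ih (u ++ (c - 1) :: (d - 1) :: w).length (by simp)
      (u ++ (c - 1) :: (d - 1) :: w) (by simp) (by
        intro x hx
        simp only [List.mem_append, List.mem_cons] at hx
        rcases hx with hx | rfl | rfl | hx
        · exact hpos x (by simp [hx])
        · omega
        · omega
        · exact hpos x (by simp [hx])) (by rwa [hred]) rfl
    simp only [List.length_append, List.length_cons, List.sum_append, List.sum_cons] at h1 h2 ⊢
    push_cast at h1 h2 ⊢
    refine ⟨by linarith, fun heq => ?_⟩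
    obtain ⟨t, ht⟩ := h2 (by linarith)
    obtain ⟨t', ht'⟩ := exists_quiddity_eq_glue ht
    exact ⟨t', by simpa using ht'⟩

theorem image_ofFn_solutions (n : ℕ) :
    List.ofFn '' {a : Fin (n + 3) → ℤ | (∀ i, 0 < a i) ∧
        (List.ofFn fun i => M (a i)).prod = -1 ∧ (∑ i, a i) = 3 * ((n + 3 : ℕ) : ℤ) - 6} =
      quiddity '' (BinaryTree.treesOfNumNodesEq (n + 1) : Set (BinaryTree Unit)) := by
  have hprod : ∀ a : Fin (n + 3) → ℤ, (List.ofFn fun i => M (a i)).prod = prodM (List.ofFn a) :=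
    fun a => by rw [prodM, List.map_ofFn]; rfl
  ext l
  simp only [Set.mem_image, Set.mem_ofPred_eq, BinaryTree.coe_treesOfNumNodesEq]
  constructor
  · rintro ⟨a, ⟨hpos, hM, hsum⟩, rfl⟩
    rw [hprod] at hM
    obtain ⟨t, ht⟩ := (conway_coxeter (List.ofFn a) (by simp)
      (List.forall_mem_ofFn_iff.2 fun i => (hpos i).le) (.inr hM)).2
      (by rw [List.sum_ofFn, List.length_ofFn, hsum])
    refine ⟨t, ?_, ht⟩
    have := congrArg List.length ht
    rw [length_quiddity, List.length_ofFn] at this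
    omega
  · rintro ⟨t, ht, rfl⟩
    have hlen : (quiddity t).length = n + 3 := by rw [length_quiddity, ht]
    obtain ⟨a, ha⟩ : ∃ a : Fin (n + 3) → ℤ, List.ofFn a = quiddity t := by
      rw [← hlen]; exact ⟨_, List.ofFn_get _⟩
    refine ⟨a, ⟨?_, ?_, ?_⟩, ha⟩
    · have := quiddity_pos (t := t) (by rintro rfl; simp at ht)
      rwa [← ha, List.forall_mem_ofFn_iff] at this
    · rw [hprod, ha, prodM_quiddity]
    · rw [← List.sum_ofFn, ha, sum_quiddity, ht]; push_cast; ring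

theorem stmt3 (N : ℕ) (hN : 3 ≤ N) :
    Set.ncard {a : Fin N → ℤ | (∀ i, 0 < a i) ∧
        (List.ofFn fun i => M (a i)).prod = -1 ∧
        (∑ i, a i) = 3 * (N : ℤ) - 6} = catalan (N - 2) ∧
    (catalan (N - 2) : ℚ) =
      (1 / ((N : ℚ) - 1)) * (Nat.choose (2 * (N - 2)) (N - 2) : ℚ) := by
  obtain ⟨n, rfl⟩ := Nat.exists_eq_add_of_le' hN
  have hn : n + 3 - 2 = n + 1 := by omega
  rw [hn]
  constructor
  · rw [← Set.ncard_image_of_injective _ List.ofFn_injective, image_ofFn_solutions,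
      Set.ncard_image_of_injective _ quiddity_injective, Set.ncard_coe_finset,
      BinaryTree.treesOfNumNodesEq_card_eq_catalan]
  · have h := succ_mul_catalan_eq_centralBinom (n + 1)
    rw [Nat.centralBinom] at h
    have hq : ((n : ℚ) + 1 + 1) * catalan (n + 1) = ((2 * (n + 1)).choose (n + 1) : ℕ) := by
      rw [← h]; push_cast; ring
    rw [← hq]
    push_cast
    have : (n : ℚ) + 3 - 1 ≠ 0 := by
      have : (0 : ℚ) ≤ n := n.cast_nonneg
      linarith
    field_simp
    ring
end

section
/- For all integers a, b, a′, a″ the following matrix identities hold: (i) M(a+1)·M(1)·M(b+1) = M(a)·M(b); (ii) M(a′)·M(1)·M(1)·M(a″) = −M(a′ + a″ − 1). Consequently, if (a_1, …, a_N) are integers with M(a_1)···M(a_N) = ε·Id for ε ∈ {1, −1}, then for any 1 ≤ i < N the blown-up tuple (a_1, …, a_{i−1}, a_i + 1, 1, a_{i+1} + 1, a_{i+2}, …, a_N) satisfies the same equation with the same sign ε, and for any integers a′, a″ with a′ + a″ = a_i + 1 the expanded tuple (a_1, …, a_{i−1}, a′, 1, 1, a″, a_{i+1}, …, a_N) satisfies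 the equation with sign −ε; in particular both operations preserve the property that the product of the matrices M(a_j) is ±Id, the blow-up increasing the length by 1 and the total sum by 3, and the expansion increasing the length by 3 and the total sum by 3. -/
theorem M_blowup (a b : ℤ) : M (a + 1) * M 1 * M (b + 1) = M a * M b := by
  ext i j
  fin_cases i <;> fin_cases j <;> simp [M, Matrix.mul_apply, Fin.sum_univ_two] <;> ring

theorem M_expansion (a b : ℤ) : M a * M 1 * M 1 * M b = -M (a + b - 1) := by
  ext i j
  fin_cases i <;> fin_cases j <;> simp [M, Matrix.mul_apply, Fin.sum_univ_two] <;> ring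

theorem stmt18 :
    (∀ a b : ℤ, M (a + 1) * M 1 * M (b + 1) = M a * M b) ∧
    (∀ a' a'' : ℤ, M a' * M 1 * M 1 * M a'' = -M (a' + a'' - 1)) ∧
    (∀ (l₁ l₂ : List ℤ) (x y ε : ℤ), (ε = 1 ∨ ε = -1) →
      ((l₁ ++ x :: y :: l₂).map M).prod = ε • (1 : Matrix (Fin 2) (Fin 2) ℤ) →
      (((l₁ ++ (x + 1) :: 1 :: (y + 1) :: l₂).map M).prod
          = ε • (1 : Matrix (Fin 2) (Fin 2) ℤ) ∧
        (l₁ ++ (x + 1) :: 1 :: (y + 1) :: l₂).length = (l₁ ++ x :: y :: l₂).length + 1 ∧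
        (l₁ ++ (x + 1) :: 1 :: (y + 1) :: l₂).sum = (l₁ ++ x :: y :: l₂).sum + 3)) ∧
    (∀ (l₁ l₂ : List ℤ) (x a' a'' ε : ℤ), (ε = 1 ∨ ε = -1) → a' + a'' = x + 1 →
      ((l₁ ++ x :: l₂).map M).prod = ε • (1 : Matrix (Fin 2) (Fin 2) ℤ) →
      (((l₁ ++ a' :: 1 :: 1 :: a'' :: l₂).map M).prod
          = (-ε) • (1 : Matrix (Fin 2) (Fin 2) ℤ) ∧
        (l₁ ++ a' :: 1 :: 1 :: a'' :: l₂).length = (l₁ ++ x :: l₂).length + 3 ∧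
        (l₁ ++ a' :: 1 :: 1 :: a'' :: l₂).sum = (l₁ ++ x :: l₂).sum + 3)) := by
  refine ⟨M_blowup, M_expansion, ?_, ?_⟩
  · intro l₁ l₂ x y ε _ h
    refine ⟨?_, by simp; ring, by simp; ring⟩
    rw [← h]
    simp only [List.map_append, List.map_cons, List.prod_append, List.prod_cons]
    rw [← mul_assoc (M x), ← M_blowup x y]
    simp only [mul_assoc]
  · intro l₁ l₂ x a b ε _ hab h
    refine ⟨?_, by simp; ring, by simp; linarith⟩
    obtain rfl : x = a + b - 1 := by linarith
    rw [neg_smul, ← h]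
    simp only [List.map_append, List.map_cons, List.prod_append, List.prod_cons]
    rw [← mul_neg, ← neg_mul, ← M_expansion a b]
    simp only [mul_assoc]
end
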